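/- Let d ≥ 1 and 1 < p < 1 + 2/d. Then for all real numbers 0 ≤ λ' ≤ λ one has the subadditivity inequality J(λ) ≤ J(λ') + J(λ − λ'). -/

import Mathlib

open MeasureTheory Real Filter Topology

noncomputable section

/-- Euclidean space `ℝ^d`. -/
abbrev Ed (d : ℕ) : Type := EuclideanSpace ℝ (Fin d)

/-- An admissible `N`-tuple: each component is continuously differentiable,
square-integrable with square-integrable gradient, and the components are
orthonormal in `L²(ℝ^d)`. -/
structure Admissible (d N : ℕ) (u : Fin N → Ed d → ℂ) : Prop where
  contDiff : ∀ n, ContDiff ℝ 1 (u n)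
  sqInt : ∀ n, Integrable (fun x : Ed d => ‖u n x‖ ^ 2)
  gradSqInt : ∀ n, Integrable (fun x : Ed d => ‖fderiv ℝ (u n) x‖ ^ 2)
  orthonormal : ∀ j k, ∫ x : Ed d, u j x * (starRingEnd ℂ) (u k x)
      = if j = k then 1 else 0

/-- The density `ρ_u = ∑ₙ |uₙ|²` of an `N`-tuple. -/
def density (d N : ℕ) (u : Fin N → Ed d → ℂ) (x : Ed d) : ℝ :=
  ∑ n, ‖u n x‖ ^ 2

/-- The NLS energy of an `N`-tuple. -/
def energy (d N : ℕ) (p : ℝ) (u : Fin N → Ed d → ℂ) : ℝ :=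
  (∑ n, ∫ x : Ed d, ‖fderiv ℝ (u n) x‖ ^ 2)
    - (1 / p) * ∫ x : Ed d, density d N u x ^ p

/-- `J(N)`: the infimum of the energy over admissible `N`-tuples. -/
def J (d : ℕ) (p : ℝ) (N : ℕ) : ℝ :=
  sInf { e : ℝ | ∃ u : Fin N → Ed d → ℂ, Admissible d N u ∧ e = energy d N p u }

/-- The occupation weight: `λ - N + 1` on the last index, `1` otherwise. -/
def wt (N : ℕ) (lam : ℝ) (n : Fin N) : ℝ :=
  if (n : ℕ) = N - 1 then lam - N + 1 else 1

/-- The weighted density `ρ_{u,λ}`. -/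
def densityW (d N : ℕ) (lam : ℝ) (u : Fin N → Ed d → ℂ) (x : Ed d) : ℝ :=
  ∑ n, wt N lam n * ‖u n x‖ ^ 2

/-- The weighted kinetic energy `T_λ(u)`. -/
def kineticW (d N : ℕ) (lam : ℝ) (u : Fin N → Ed d → ℂ) : ℝ :=
  ∑ n, wt N lam n * ∫ x : Ed d, ‖fderiv ℝ (u n) x‖ ^ 2

/-- The weighted energy `E_λ(u)`. -/
def energyW (d N : ℕ) (p lam : ℝ) (u : Fin N → Ed d → ℂ) : ℝ :=
  kineticW d N lam u - (1 / p) * ∫ x : Ed d, densityW d N lam u x ^ p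

/-- `J(λ)` for real `λ`: the infimum of the weighted energy over admissible
`⌈λ⌉`-tuples. -/
def Jw (d : ℕ) (p : ℝ) (lam : ℝ) : ℝ :=
  sInf { e : ℝ | ∃ u : Fin ⌈lam⌉₊ → Ed d → ℂ,
    Admissible d ⌈lam⌉₊ u ∧ e = energyW d ⌈lam⌉₊ p lam u }

/-- The one-function NLS infimum `I(d,p,λ)`. -/
def Infimum1 (d : ℕ) (p lam : ℝ) : ℝ :=
  sInf { e : ℝ | ∃ u : Ed d → ℂ, ContDiff ℝ 1 u ∧
    Integrable (fun x : Ed d => ‖u x‖ ^ 2) ∧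
    Integrable (fun x : Ed d => ‖fderiv ℝ u x‖ ^ 2) ∧
    (∫ x : Ed d, ‖u x‖ ^ 2) = lam ∧
    e = (∫ x : Ed d, ‖fderiv ℝ u x‖ ^ 2)
        - (1 / p) * ∫ x : Ed d, ‖u x‖ ^ (2 * p) }

/-- The Laplacian of `f : ℝ^d → ℂ`, as the sum of the second partial
derivatives in the coordinate directions. -/
def lap (d : ℕ) (f : Ed d → ℂ) (x : Ed d) : ℂ :=
  ∑ i : Fin d,
    fderiv ℝ (fun y => fderiv ℝ f y (EuclideanSpace.single i (1 : ℝ))) x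
      (EuclideanSpace.single i (1 : ℝ))

/-- The `q`-spherical average `[f]_q(x)`, computed with respect to the surface
measure on the unit sphere. -/
def sphAvg (d : ℕ) (q : ℝ) (f : Ed d → ℝ) (x : Ed d) : ℝ :=
  (∫ ω : Metric.sphere (0 : Ed d) 1, |f (‖x‖ • (ω : Ed d))| ^ q
      ∂((volume : Measure (Ed d)).toSphere)) ^ (1 / q)

/-- The surface measure of the unit sphere `S^{d-1} ⊂ ℝ^d`. -/
def omegaSphere (d : ℕ) : ℝ :=
  (((volume : Measure (Ed d)).toSphere) Set.univ).toReal

/-- The Thomas–Fermi constant. -/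
def cTF (d : ℕ) : ℝ :=
  (4 * π ^ 2 * d / (d + 2)) * ((d : ℝ) / omegaSphere d) ^ (2 / (d : ℝ))


theorem sq_integral_le_integral_sq {g : ℝ → ℝ} (hg : Continuous g) :
    (∫ t in (0 : ℝ)..1, g t) ^ 2 ≤ ∫ t in (0 : ℝ)..1, g t ^ 2 := by
  set c := ∫ t in (0 : ℝ)..1, g t with hc
  have h0 : 0 ≤ ∫ t in (0 : ℝ)..1, (g t - c) ^ 2 :=
    intervalIntegral.integral_nonneg zero_le_one fun t _ => sq_nonneg _
  have h1 : ∫ t in (0 : ℝ)..1, (g t - c) ^ 2 = (∫ t in (0 : ℝ)..1, g t ^ 2) - c ^ 2 := by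
    have : ∀ t, (g t - c) ^ 2 = g t ^ 2 - (2 * c) * g t + c ^ 2 := fun t => by ring
    simp_rw [this]
    rw [intervalIntegral.integral_add, intervalIntegral.integral_sub,
      intervalIntegral.integral_const_mul, ← hc]
    · simp; ring
    all_goals exact Continuous.intervalIntegrable (by fun_prop) _ _
  linarith

theorem norm_sub_sq_le_integral {d : ℕ} {u : Ed d → ℂ} (hu : ContDiff ℝ 1 u) (x y : Ed d) :
    ‖u (x + y) - u x‖ ^ 2 ≤ ‖y‖ ^ 2 * ∫ t in (0 : ℝ)..1, ‖fderiv ℝ u (x + t • y)‖ ^ 2 := by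
  have hcf : Continuous (fderiv ℝ u) := hu.continuous_fderiv one_ne_zero
  have hg : Continuous fun t : ℝ => ‖fderiv ℝ u (x + t • y)‖ := by fun_prop
  have hder : ∀ t : ℝ, HasDerivAt (fun t : ℝ => u (x + t • y)) (fderiv ℝ u (x + t • y) y) t := by
    intro t
    have h1 : HasDerivAt (fun t : ℝ => x + t • y) y t := by
      simpa using ((hasDerivAt_id t).smul_const y).const_add x
    exact ((hu.differentiable one_ne_zero) (x + t • y)).hasFDerivAt.comp_hasDerivAt t h1
  have hftc : u (x + y) - u x = ∫ t in (0 : ℝ)..1, fderiv ℝ u (x + t • y) y := by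
    rw [intervalIntegral.integral_eq_sub_of_hasDerivAt (fun t _ => hder t)]
    · simp
    · exact Continuous.intervalIntegrable (by fun_prop) _ _
  have hle : ‖u (x + y) - u x‖ ≤ (∫ t in (0 : ℝ)..1, ‖fderiv ℝ u (x + t • y)‖) * ‖y‖ := by
    rw [hftc, ← intervalIntegral.integral_mul_const]
    refine (intervalIntegral.norm_integral_le_integral_norm zero_le_one).trans ?_
    refine intervalIntegral.integral_mono_on zero_le_one ?_ ?_ fun t _ =>
      (fderiv ℝ u (x + t • y)).le_opNorm y
    all_goals exact Continuous.intervalIntegrable (by fun_prop) _ _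
  calc ‖u (x + y) - u x‖ ^ 2 ≤ ((∫ t in (0 : ℝ)..1, ‖fderiv ℝ u (x + t • y)‖) * ‖y‖) ^ 2 := by
        gcongr
    _ = ‖y‖ ^ 2 * (∫ t in (0 : ℝ)..1, ‖fderiv ℝ u (x + t • y)‖) ^ 2 := by ring
    _ ≤ _ := by gcongr; exact sq_integral_le_integral_sq hg

theorem lintegral_norm_translate_sub_sq_le {d : ℕ} {u : Ed d → ℂ} (hu : ContDiff ℝ 1 u)
    (y : Ed d) :
    ∫⁻ x, ENNReal.ofReal (‖u (x + y) - u x‖ ^ 2) ≤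
      ENNReal.ofReal (‖y‖ ^ 2) * ∫⁻ x, ENNReal.ofReal (‖fderiv ℝ u x‖ ^ 2) := by
  have hcf : Continuous (fderiv ℝ u) := hu.continuous_fderiv one_ne_zero
  have hpt : ∀ x, ENNReal.ofReal (‖u (x + y) - u x‖ ^ 2) ≤ ENNReal.ofReal (‖y‖ ^ 2) *
      ∫⁻ t in Set.Ioc (0 : ℝ) 1, ENNReal.ofReal (‖fderiv ℝ u (x + t • y)‖ ^ 2) := by
    intro x
    have hInt : IntervalIntegrable (fun t : ℝ => ‖fderiv ℝ u (x + t • y)‖ ^ 2) volume 0 1 :=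
      Continuous.intervalIntegrable (by fun_prop) _ _
    rw [← ofReal_integral_eq_lintegral_ofReal
      ((intervalIntegrable_iff_integrableOn_Ioc_of_le zero_le_one).1 hInt)
      (Eventually.of_forall fun t => by positivity),
      ← ENNReal.ofReal_mul (by positivity), ← intervalIntegral.integral_of_le zero_le_one]
    exact ENNReal.ofReal_le_ofReal (norm_sub_sq_le_integral hu x y)
  refine (lintegral_mono hpt).trans ?_
  rw [lintegral_const_mul' _ _ ENNReal.ofReal_ne_top]
  gcongr ENNReal.ofReal _ * ?_
  rw [lintegral_lintegral_swap]
  · have : ∀ t : ℝ, ∫⁻ x : Ed d, ENNReal.ofReal (‖fderiv ℝ u (x + t • y)‖ ^ 2)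
        = ∫⁻ x, ENNReal.ofReal (‖fderiv ℝ u x‖ ^ 2) := fun t =>
      lintegral_add_right_eq_self (fun x => ENNReal.ofReal (‖fderiv ℝ u x‖ ^ 2)) (t • y)
    simp_rw [this]
    simp
  · refine Continuous.aemeasurable ?_
    refine ENNReal.continuous_ofReal.comp ?_
    fun_prop

theorem norm_sq_le_average_of_large {d : ℕ} {u : Ed d → ℂ} (hu : ContDiff ℝ 1 u)
    (h1 : ∫⁻ x, ENNReal.ofReal (‖u x‖ ^ 2) = 1) {B : Set (Ed d)} {V : ℝ} (hV : 0 < V)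
    (hBV : volume B = ENNReal.ofReal V) {x : Ed d} (hx : 4 / V ≤ ‖u x‖ ^ 2) :
    ENNReal.ofReal (‖u x‖ ^ 2) ≤ ENNReal.ofReal (4 / V) *
      ∫⁻ y in B, ENNReal.ofReal (‖u (x + y) - u x‖ ^ 2) := by
  have hc := hu.continuous
  set I := ∫⁻ y in B, ENNReal.ofReal (‖u (x + y) - u x‖ ^ 2) with hI
  have key : ENNReal.ofReal (‖u x‖ ^ 2) * ENNReal.ofReal V ≤ 2 * I + 2 := by
    calc ENNReal.ofReal (‖u x‖ ^ 2) * ENNReal.ofReal V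
        = ∫⁻ _ in B, ENNReal.ofReal (‖u x‖ ^ 2) := by rw [setLIntegral_const, hBV]
      _ ≤ ∫⁻ y in B, (2 * ENNReal.ofReal (‖u (x + y) - u x‖ ^ 2)
            + 2 * ENNReal.ofReal (‖u (x + y)‖ ^ 2)) := by
          refine lintegral_mono fun y => ?_
          have : ‖u x‖ ^ 2 ≤ 2 * ‖u (x + y) - u x‖ ^ 2 + 2 * ‖u (x + y)‖ ^ 2 := by
            have h := norm_sub_le (u (x + y)) (u (x + y) - u x)
            rw [sub_sub_cancel] at h
            nlinarith [sq_nonneg (‖u (x + y)‖ - ‖u (x + y) - u x‖), norm_nonneg (u x)]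
          refine (ENNReal.ofReal_le_ofReal this).trans ?_
          rw [ENNReal.ofReal_add (by positivity) (by positivity),
            ENNReal.ofReal_mul zero_le_two, ENNReal.ofReal_mul zero_le_two]
          simp
      _ = 2 * I + 2 * ∫⁻ y in B, ENNReal.ofReal (‖u (x + y)‖ ^ 2) := by
          rw [lintegral_add_left (by fun_prop), lintegral_const_mul' _ _ (by simp),
            lintegral_const_mul' _ _ (by simp)]
      _ ≤ 2 * I + 2 * 1 := by
          gcongr
          refine (setLIntegral_le_lintegral _ _).trans ?_
          rw [lintegral_add_left_eq_self (fun y => ENNReal.ofReal (‖u y‖ ^ 2)) x, h1]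
      _ = 2 * I + 2 := by rw [mul_one]
  by_cases hIt : I = ⊤
  · rw [hIt, ENNReal.mul_top (by simp; positivity)]; exact le_top
  · rw [← ENNReal.ofReal_toReal hIt] at key ⊢
    rw [← ENNReal.ofReal_mul (by positivity)] at key ⊢
    have h2 : (2 : ENNReal) = ENNReal.ofReal 2 := by simp
    rw [h2, ← ENNReal.ofReal_mul (by positivity), ← ENNReal.ofReal_add (by positivity)
      (by positivity), ENNReal.ofReal_le_ofReal_iff (by positivity)] at key
    refine ENNReal.ofReal_le_ofReal ?_
    rw [div_le_iff₀ hV] at hx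
    rw [div_mul_eq_mul_div, le_div_iff₀ hV]
    linarith

theorem setLIntegral_norm_sq_large_le {d : ℕ} {u : Ed d → ℂ} (hu : ContDiff ℝ 1 u)
    (h1 : ∫⁻ x, ENNReal.ofReal (‖u x‖ ^ 2) = 1) {r V : ℝ} (hV : 0 < V)
    (hBV : volume (Metric.ball (0 : Ed d) r) = ENNReal.ofReal V) :
    ∫⁻ x in {x | 4 / V ≤ ‖u x‖ ^ 2}, ENNReal.ofReal (‖u x‖ ^ 2) ≤
      ENNReal.ofReal (4 * r ^ 2) * ∫⁻ x, ENNReal.ofReal (‖fderiv ℝ u x‖ ^ 2) := by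
  have hc := hu.continuous
  have hms : MeasurableSet {x | 4 / V ≤ ‖u x‖ ^ 2} :=
    (isClosed_le continuous_const (by fun_prop)).measurableSet
  set T := ∫⁻ x, ENNReal.ofReal (‖fderiv ℝ u x‖ ^ 2)
  calc ∫⁻ x in {x | 4 / V ≤ ‖u x‖ ^ 2}, ENNReal.ofReal (‖u x‖ ^ 2)
      ≤ ∫⁻ x in {x | 4 / V ≤ ‖u x‖ ^ 2}, ENNReal.ofReal (4 / V) *
      ∫⁻ y in Metric.ball (0 : Ed d) r, ENNReal.ofReal (‖u (x + y) - u x‖ ^ 2) :=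
        setLIntegral_mono' hms fun x hx => norm_sq_le_average_of_large hu h1 hV hBV hx
    _ ≤ ∫⁻ x, ENNReal.ofReal (4 / V) *
      ∫⁻ y in Metric.ball (0 : Ed d) r, ENNReal.ofReal (‖u (x + y) - u x‖ ^ 2) :=
        setLIntegral_le_lintegral _ _
    _ = ENNReal.ofReal (4 / V) * ∫⁻ y in Metric.ball (0 : Ed d) r,
          ∫⁻ x, ENNReal.ofReal (‖u (x + y) - u x‖ ^ 2) := by
        rw [lintegral_const_mul' _ _ ENNReal.ofReal_ne_top, lintegral_lintegral_swap]
        refine Continuous.aemeasurable (ENNReal.continuous_ofReal.comp ?_)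
        fun_prop
    _ ≤ ENNReal.ofReal (4 / V) * ∫⁻ y in Metric.ball (0 : Ed d) r,
          ENNReal.ofReal (r ^ 2) * T := by
        gcongr 1
        refine setLIntegral_mono' measurableSet_ball fun y hy => ?_
        refine (lintegral_norm_translate_sub_sq_le hu y).trans ?_
        gcongr
        exact (mem_ball_zero_iff.1 hy).le
    _ = ENNReal.ofReal (4 * r ^ 2) * T := by
        rw [setLIntegral_const, hBV, mul_comm (_ * T), ← mul_assoc, ← mul_assoc,
          ← ENNReal.ofReal_mul (by positivity), ← ENNReal.ofReal_mul (by positivity)]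
        congr 2
        field_simp

/-- Mass of `‖u‖²` above the level `t` is controlled by the kinetic energy. -/
theorem exists_setLIntegral_norm_sq_le (d : ℕ) (hd : 1 ≤ d) :
    ∃ C : ℝ, 0 < C ∧ ∀ u : Ed d → ℂ, ContDiff ℝ 1 u →
      ∫⁻ x, ENNReal.ofReal (‖u x‖ ^ 2) = 1 → ∀ t : ℝ, 0 < t →
      ∫⁻ x in {x | t ≤ ‖u x‖ ^ 2}, ENNReal.ofReal (‖u x‖ ^ 2) ≤
        ENNReal.ofReal (C * t ^ (-(2 / (d : ℝ)))) *
          ∫⁻ x, ENNReal.ofReal (‖fderiv ℝ u x‖ ^ 2) := by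
  have hd0 : (d : ℝ) ≠ 0 := by positivity
  set v := (volume (Metric.ball (0 : Ed d) 1)).toReal with hv
  have hvpos : 0 < v := ENNReal.toReal_pos (Metric.measure_ball_pos _ _ one_pos).ne'
    measure_ball_lt_top.ne
  refine ⟨4 * (4 / v) ^ (2 / (d : ℝ)), by positivity, fun u hu h1 t ht => ?_⟩
  set r := (4 / (v * t)) ^ (1 / (d : ℝ)) with hr
  have hrd : r ^ d = 4 / (v * t) := by
    rw [hr, ← Real.rpow_natCast, ← Real.rpow_mul (by positivity), one_div_mul_cancel hd0,
      Real.rpow_one]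
  have hball : volume (Metric.ball (0 : Ed d) r) = ENNReal.ofReal (4 / t) := by
    rw [Measure.addHaar_ball_of_pos volume 0 (by positivity), finrank_euclideanSpace_fin, hrd,
      ← ENNReal.ofReal_toReal (measure_ball_lt_top (x := (0 : Ed d)) (r := 1)).ne, ← hv,
      ← ENNReal.ofReal_mul (by positivity)]
    congr 1
    field_simp
  have h := setLIntegral_norm_sq_large_le hu h1 (by positivity) hball
  have h4 : 4 / (4 / t) = t := by field_simp
  have hr2 : 4 * r ^ 2 = 4 * (4 / v) ^ (2 / (d : ℝ)) * t ^ (-(2 / (d : ℝ))) := by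
    rw [hr, ← Real.rpow_natCast, ← Real.rpow_mul (by positivity), Real.rpow_neg ht.le, mul_assoc,
      ← div_div, Real.div_rpow (by positivity) ht.le, ← div_eq_mul_inv]
    congr 3 <;> push_cast <;> ring
  rwa [h4, hr2] at h

theorem ofReal_rpow_le_dyadic {p A s : ℝ} (hp : 1 < p) (hA : 0 < A) (hs : 0 ≤ s) :
    ENNReal.ofReal (s ^ p) ≤ ENNReal.ofReal (A ^ (p - 1)) * ENNReal.ofReal s +
      ∑' k : ℕ, ENNReal.ofReal ((A * 2 ^ (k + 1)) ^ (p - 1)) *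
        (Set.Ici (A * 2 ^ k)).indicator ENNReal.ofReal s := by
  have hsp : s ^ p = s ^ (p - 1) * s := by
    rcases hs.eq_or_lt with rfl | h
    · rw [Real.zero_rpow (by linarith), mul_zero]
    · rw [← Real.rpow_add_one h.ne', sub_add_cancel]
  rw [hsp, ENNReal.ofReal_mul (by positivity)]
  rcases le_total s A with h | h
  · refine le_add_right ?_
    gcongr
  · obtain ⟨k, hk1, hk2⟩ := exists_nat_pow_near (x := s / A) (y := 2)
      ((one_le_div hA).2 h) one_lt_two
    rw [le_div_iff₀ hA] at hk1
    rw [div_lt_iff₀ hA] at hk2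
    refine le_add_left (le_trans ?_ (ENNReal.le_tsum k))
    rw [Set.indicator_of_mem (by rw [Set.mem_Ici]; linarith)]
    gcongr
    linarith

/-- A subcritical Gagliardo–Nirenberg inequality in lower-Lebesgue-integral form. -/
theorem lintegral_rpow_le (d : ℕ) (hd : 1 ≤ d) {p : ℝ} (hp1 : 1 < p) (hp2 : p < 1 + 2 / d)
    {ε : ℝ} (hε : 0 < ε) :
    ∃ C : ℝ, 0 ≤ C ∧ ∀ u : Ed d → ℂ, ContDiff ℝ 1 u →
      ∫⁻ x, ENNReal.ofReal (‖u x‖ ^ 2) = 1 →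
      ∫⁻ x, ENNReal.ofReal ((‖u x‖ ^ 2) ^ p) ≤ ENNReal.ofReal C +
        ENNReal.ofReal ε * ∫⁻ x, ENNReal.ofReal (‖fderiv ℝ u x‖ ^ 2) := by
  obtain ⟨C₀, hC₀, hlevel⟩ := exists_setLIntegral_norm_sq_le d hd
  set β := 2 / (d : ℝ) - (p - 1) with hβ
  have hβpos : 0 < β := by linarith
  set q : ℝ := 2 ^ (-β) with hq
  have hq0 : 0 < q := by positivity
  have hq1 : q < 1 := Real.rpow_lt_one_of_one_lt_of_neg one_lt_two (by linarith)
  set M : ℝ := C₀ * 2 ^ (p - 1) * (1 - q)⁻¹ with hM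
  have hlim : Tendsto (fun A : ℝ => M * A ^ (-β)) atTop (𝓝 0) := by
    simpa using (tendsto_rpow_neg_atTop hβpos).const_mul M
  obtain ⟨A, hAε, hA⟩ := ((hlim.eventually (ge_mem_nhds hε)).and (eventually_gt_atTop 0)).exists
  refine ⟨A ^ (p - 1), by positivity, fun u hu h1 => ?_⟩
  have hc := hu.continuous
  set T := ∫⁻ x, ENNReal.ofReal (‖fderiv ℝ u x‖ ^ 2)
  have hind : ∀ k : ℕ, (fun x => (Set.Ici (A * 2 ^ k)).indicator ENNReal.ofReal (‖u x‖ ^ 2)) =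
      {x | A * 2 ^ k ≤ ‖u x‖ ^ 2}.indicator (fun x => ENNReal.ofReal (‖u x‖ ^ 2)) := by
    intro k
    ext x
    simp [Set.indicator]
  have hms : ∀ k : ℕ, MeasurableSet {x | A * 2 ^ k ≤ ‖u x‖ ^ 2} := fun k =>
    (isClosed_le continuous_const (by fun_prop)).measurableSet
  have hmeas : ∀ k : ℕ, Measurable
      (fun x => (Set.Ici (A * 2 ^ k)).indicator ENNReal.ofReal (‖u x‖ ^ 2)) := by
    intro k
    rw [hind]
    exact Measurable.indicator (by fun_prop) (hms k)
  have hterm : ∀ k : ℕ, ((A * 2 ^ (k + 1)) ^ (p - 1)) * (C₀ * (A * 2 ^ k) ^ (-(2 / (d : ℝ))))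
      = (C₀ * 2 ^ (p - 1) * A ^ (-β)) * q ^ k := by
    intro k
    have e1 : (A * 2 ^ (k + 1)) ^ (p - 1) = (A * 2 ^ k) ^ (p - 1) * 2 ^ (p - 1) := by
      rw [← Real.mul_rpow (by positivity) (by positivity), pow_succ, mul_assoc]
    have e2 : (A * 2 ^ k) ^ (-β) = A ^ (-β) * q ^ k := by
      rw [Real.mul_rpow hA.le (by positivity), hq, ← Real.rpow_natCast, ← Real.rpow_natCast,
        ← Real.rpow_mul zero_le_two, ← Real.rpow_mul zero_le_two, mul_comm (k : ℝ)]
    have e3 : (A * 2 ^ k) ^ (-β) = (A * 2 ^ k) ^ (p - 1) * (A * 2 ^ k) ^ (-(2 / (d : ℝ))) := by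
      rw [← Real.rpow_add (by positivity)]
      congr 1
      rw [hβ]; ring
    rw [e1, mul_assoc (C₀ * _), ← e2, e3]
    ring
  calc ∫⁻ x, ENNReal.ofReal ((‖u x‖ ^ 2) ^ p)
      ≤ ∫⁻ x, (ENNReal.ofReal (A ^ (p - 1)) * ENNReal.ofReal (‖u x‖ ^ 2) +
      ∑' k : ℕ, ENNReal.ofReal ((A * 2 ^ (k + 1)) ^ (p - 1)) *
        (Set.Ici (A * 2 ^ k)).indicator ENNReal.ofReal (‖u x‖ ^ 2)) :=
        lintegral_mono fun x => ofReal_rpow_le_dyadic hp1 hA (by positivity)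
    _ = ENNReal.ofReal (A ^ (p - 1)) + ∑' k : ℕ, ENNReal.ofReal ((A * 2 ^ (k + 1)) ^ (p - 1)) *
        ∫⁻ x in {x | A * 2 ^ k ≤ ‖u x‖ ^ 2}, ENNReal.ofReal (‖u x‖ ^ 2) := by
        rw [lintegral_add_left (by fun_prop), lintegral_const_mul' _ _ ENNReal.ofReal_ne_top, h1,
          mul_one, lintegral_tsum fun k => ((hmeas k).const_mul _).aemeasurable]
        congr 2
        ext k
        rw [lintegral_const_mul' _ _ ENNReal.ofReal_ne_top, hind, lintegral_indicator (hms k)]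
    _ ≤ ENNReal.ofReal (A ^ (p - 1)) + ∑' k : ℕ,
          ENNReal.ofReal ((C₀ * 2 ^ (p - 1) * A ^ (-β)) * q ^ k) * T := by
        refine add_le_add_right (ENNReal.tsum_le_tsum fun k => ?_) _
        refine (mul_le_mul_right (hlevel u hu h1 (A * 2 ^ k) (by positivity)) _).trans_eq ?_
        rw [← mul_assoc, ← ENNReal.ofReal_mul (by positivity), hterm]
    _ = ENNReal.ofReal (A ^ (p - 1)) + ENNReal.ofReal (M * A ^ (-β)) * T := by
        rw [ENNReal.tsum_mul_right, ← ENNReal.ofReal_tsum_of_nonneg (fun k => by positivity)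
          ((summable_geometric_of_lt_one hq0.le hq1).mul_left _), tsum_mul_left,
          tsum_geometric_of_lt_one hq0.le hq1]
        congr 3
        rw [hM]; ring
    _ ≤ _ := by gcongr

/-- A subcritical Gagliardo–Nirenberg inequality for normalized functions. -/
theorem integral_rpow_le (d : ℕ) (hd : 1 ≤ d) {p : ℝ} (hp1 : 1 < p) (hp2 : p < 1 + 2 / d)
    {ε : ℝ} (hε : 0 < ε) :
    ∃ C : ℝ, 0 ≤ C ∧ ∀ u : Ed d → ℂ, ContDiff ℝ 1 u → Integrable (fun x => ‖u x‖ ^ 2) →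
      Integrable (fun x => ‖fderiv ℝ u x‖ ^ 2) → ∫ x, ‖u x‖ ^ 2 = 1 →
      Integrable (fun x => (‖u x‖ ^ 2) ^ p) ∧
      ∫ x, (‖u x‖ ^ 2) ^ p ≤ C + ε * ∫ x, ‖fderiv ℝ u x‖ ^ 2 := by
  obtain ⟨C, hC, h⟩ := lintegral_rpow_le d hd hp1 hp2 hε
  refine ⟨C, hC, fun u hu hi hg h1 => ?_⟩
  have hc := hu.continuous
  have hT : 0 ≤ ∫ x, ‖fderiv ℝ u x‖ ^ 2 := integral_nonneg fun x => by positivity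
  have h' := h u hu (by
    rw [← ofReal_integral_eq_lintegral_ofReal hi (Eventually.of_forall fun x => by positivity),
      h1, ENNReal.ofReal_one])
  rw [← ofReal_integral_eq_lintegral_ofReal hg (Eventually.of_forall fun x => by positivity),
    ← ENNReal.ofReal_mul hε.le, ← ENNReal.ofReal_add hC (by positivity)] at h'
  have hcont : Continuous fun x => (‖u x‖ ^ 2) ^ p :=
    Continuous.rpow_const (by fun_prop) fun x => Or.inr (by linarith)
  have hInt : Integrable (fun x => (‖u x‖ ^ 2) ^ p) := by
    refine ⟨hcont.aestronglyMeasurable, ?_⟩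
    rw [hasFiniteIntegral_iff_ofReal (Eventually.of_forall fun x => by positivity)]
    exact h'.trans_lt ENNReal.ofReal_lt_top
  refine ⟨hInt, ?_⟩
  rw [← ofReal_integral_eq_lintegral_ofReal hInt (Eventually.of_forall fun x => by positivity),
    ENNReal.ofReal_le_ofReal_iff (by positivity)] at h'
  exact h'

/-- A family of `C¹` functions in `H¹(ℝ^d)`. -/
structure SobolevFamily (d : ℕ) (ι : Type) (u : ι → Ed d → ℂ) : Prop where
  contDiff : ∀ n, ContDiff ℝ 1 (u n)
  sqInt : ∀ n, Integrable (fun x : Ed d => ‖u n x‖ ^ 2)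
  gradSqInt : ∀ n, Integrable (fun x : Ed d => ‖fderiv ℝ (u n) x‖ ^ 2)

/-- The Gram matrix of a family in `L²(ℝ^d)`. -/
def gram (d : ℕ) (ι : Type) (u : ι → Ed d → ℂ) : Matrix ι ι ℂ :=
  fun j k => ∫ x : Ed d, u j x * (starRingEnd ℂ) (u k x)

/-- The density with occupation weights `ω`. -/
def weightedDensity (d : ℕ) {ι : Type} [Fintype ι] (ω : ι → ℝ) (u : ι → Ed d → ℂ) (x : Ed d) : ℝ :=
  ∑ n, ω n * ‖u n x‖ ^ 2

/-- The kinetic energy with occupation weights `ω`. -/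
def weightedKinetic (d : ℕ) {ι : Type} [Fintype ι] (ω : ι → ℝ) (u : ι → Ed d → ℂ) : ℝ :=
  ∑ n, ω n * ∫ x : Ed d, ‖fderiv ℝ (u n) x‖ ^ 2

/-- The energy with occupation weights `ω`. -/
def weightedEnergy (d : ℕ) (p : ℝ) {ι : Type} [Fintype ι] (ω : ι → ℝ) (u : ι → Ed d → ℂ) : ℝ :=
  weightedKinetic d ω u - (1 / p) * ∫ x : Ed d, weightedDensity d ω u x ^ p

section families

variable {d : ℕ} {ι : Type} {u : ι → Ed d → ℂ}

theorem Admissible.sobolevFamily {N : ℕ} {u : Fin N → Ed d → ℂ} (h : Admissible d N u) :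
    SobolevFamily d (Fin N) u := ⟨h.contDiff, h.sqInt, h.gradSqInt⟩

theorem Admissible.gram_eq_one {N : ℕ} {u : Fin N → Ed d → ℂ} (h : Admissible d N u) :
    gram d (Fin N) u = 1 := by
  ext j k
  rw [Matrix.one_apply]
  exact h.orthonormal j k

theorem integral_norm_sq_eq_one [DecidableEq ι] (h : gram d ι u = 1) (n : ι) :
    ∫ x, ‖u n x‖ ^ 2 = 1 := by
  have h1 : gram d ι u n n = 1 := by rw [h, Matrix.one_apply_eq]
  simp only [gram, Complex.mul_conj, Complex.normSq_eq_norm_sq] at h1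
  rw [integral_complex_ofReal] at h1
  exact_mod_cast h1

variable [Fintype ι]

theorem weightedDensity_nonneg {ω : ι → ℝ} (hω : ∀ n, 0 ≤ ω n) (u : ι → Ed d → ℂ) (x : Ed d) :
    0 ≤ weightedDensity d ω u x :=
  Finset.sum_nonneg fun n _ => mul_nonneg (hω n) (by positivity)

theorem SobolevFamily.continuous_weightedDensity_rpow (h : SobolevFamily d ι u) (ω : ι → ℝ)
    {p : ℝ} (hp : 0 ≤ p) : Continuous fun x => weightedDensity d ω u x ^ p := by
  refine Continuous.rpow_const ?_ fun x => Or.inr hp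
  have := fun n => (h.contDiff n).continuous
  unfold weightedDensity
  fun_prop

theorem weightedDensity_rpow_le {ω : ι → ℝ} (hω : ∀ n, 0 ≤ ω n) (hω1 : ∀ n, ω n ≤ 1)
    {p : ℝ} (hp : 1 ≤ p) (u : ι → Ed d → ℂ) (x : Ed d) :
    weightedDensity d ω u x ^ p ≤
      (Fintype.card ι : ℝ) ^ (p - 1) * ∑ n, (‖u n x‖ ^ 2) ^ p := by
  refine (Real.rpow_sum_le_const_mul_sum_rpow_of_nonneg Finset.univ hp fun n _ =>
    mul_nonneg (hω n) (by positivity)).trans ?_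
  rw [Finset.card_univ]
  gcongr with n
  · exact mul_nonneg (hω n) (by positivity)
  · exact mul_le_of_le_one_left (by positivity) (hω1 n)

theorem weightedDensity_integral_bound (hd : 1 ≤ d) {p : ℝ} (hp1 : 1 < p) (hp2 : p < 1 + 2 / d)
    (ι : Type) [Fintype ι] [DecidableEq ι] {ε : ℝ} (hε : 0 < ε) :
    ∃ C : ℝ, ∀ u : ι → Ed d → ℂ, SobolevFamily d ι u → gram d ι u = 1 →
      ∀ ω : ι → ℝ, (∀ n, 0 ≤ ω n) → (∀ n, ω n ≤ 1) →
      Integrable (fun x => weightedDensity d ω u x ^ p) ∧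
      ∫ x, weightedDensity d ω u x ^ p ≤ C + ε * ∑ n, ∫ x, ‖fderiv ℝ (u n) x‖ ^ 2 := by
  set K : ℝ := (Fintype.card ι : ℝ) ^ (p - 1) with hK
  have hK0 : 0 ≤ K := by positivity
  obtain ⟨C, hC, h⟩ := integral_rpow_le d hd hp1 hp2 (ε := ε / (K + 1)) (by positivity)
  refine ⟨K * ∑ _n : ι, C, fun u hu hG ω hω hω1 => ?_⟩
  have h' := fun n => h (u n) (hu.contDiff n) (hu.sqInt n) (hu.gradSqInt n)
    (integral_norm_sq_eq_one hG n)
  have hInt : Integrable (fun x => K * ∑ n, (‖u n x‖ ^ 2) ^ p) :=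
    (integrable_finsetSum _ fun n _ => (h' n).1).const_mul K
  have hle := fun x => weightedDensity_rpow_le hω hω1 hp1.le u x
  have hInt' : Integrable (fun x => weightedDensity d ω u x ^ p) := by
    refine hInt.mono' (hu.continuous_weightedDensity_rpow ω (by linarith)).aestronglyMeasurable
      (Eventually.of_forall fun x => ?_)
    rw [Real.norm_of_nonneg (Real.rpow_nonneg (weightedDensity_nonneg hω u x) _)]
    exact hle x
  refine ⟨hInt', (integral_mono hInt' hInt hle).trans ?_⟩
  rw [integral_const_mul, integral_finsetSum _ fun n _ => (h' n).1]
  have hT : 0 ≤ ∑ n, ∫ x, ‖fderiv ℝ (u n) x‖ ^ 2 :=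
    Finset.sum_nonneg fun n _ => integral_nonneg fun x => by positivity
  calc K * ∑ n, ∫ x, (‖u n x‖ ^ 2) ^ p
      ≤ K * ∑ n, (C + ε / (K + 1) * ∫ x, ‖fderiv ℝ (u n) x‖ ^ 2) := by
        gcongr with n
        exact (h' n).2
    _ = K * ∑ _n : ι, C + (K / (K + 1)) * (ε * ∑ n, ∫ x, ‖fderiv ℝ (u n) x‖ ^ 2) := by
        rw [Finset.sum_add_distrib, ← Finset.mul_sum]
        ring
    _ ≤ _ := by
        refine add_le_add_right (mul_le_of_le_one_left (by positivity) ?_) _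
        rw [div_le_one (by positivity)]
        linarith

theorem bddBelow_weightedEnergy (hd : 1 ≤ d) {p : ℝ} (hp1 : 1 < p) (hp2 : p < 1 + 2 / d)
    [DecidableEq ι] {ω : ι → ℝ} (hω : ∀ n, 0 < ω n) (hω1 : ∀ n, ω n ≤ 1) :
    ∃ C : ℝ, ∀ u : ι → Ed d → ℂ, SobolevFamily d ι u → gram d ι u = 1 →
      C ≤ weightedEnergy d p ω u := by
  obtain ⟨m, hm, hmω⟩ : ∃ m : ℝ, 0 < m ∧ ∀ n, m ≤ ω n := by
    have h : ∀ᶠ m in 𝓝[>] (0 : ℝ), ∀ n, m ≤ ω n := by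
      rw [eventually_all]
      exact fun n => nhdsWithin_le_nhds (ge_mem_nhds (hω n))
    obtain ⟨m, h1, h2⟩ := (h.and self_mem_nhdsWithin).exists
    exact ⟨m, h2, h1⟩
  obtain ⟨C, hC⟩ := weightedDensity_integral_bound hd hp1 hp2 ι (ε := p * m) (by positivity)
  refine ⟨-((1 / p) * C), fun u hu hG => ?_⟩
  have h := (hC u hu hG ω (fun n => (hω n).le) hω1).2
  have hkin : m * ∑ n, ∫ x, ‖fderiv ℝ (u n) x‖ ^ 2 ≤ weightedKinetic d ω u := by
    rw [Finset.mul_sum, weightedKinetic]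
    refine Finset.sum_le_sum fun n _ => ?_
    exact mul_le_mul_of_nonneg_right (hmω n) (integral_nonneg fun x => by positivity)
  have h2 : (1 / p) * ∫ x, weightedDensity d ω u x ^ p ≤
      (1 / p) * (C + p * m * ∑ n, ∫ x, ‖fderiv ℝ (u n) x‖ ^ 2) := by gcongr
  have h3 : (1 / p) * (C + p * m * ∑ n, ∫ x, ‖fderiv ℝ (u n) x‖ ^ 2) =
      (1 / p) * C + m * ∑ n, ∫ x, ‖fderiv ℝ (u n) x‖ ^ 2 := by
    field_simp
  rw [weightedEnergy]
  linarith

/-- The energy is concave in the occupation weights. -/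
theorem weightedEnergy_concave (hd : 1 ≤ d) {p : ℝ} (hp1 : 1 < p) (hp2 : p < 1 + 2 / d)
    [DecidableEq ι] (hu : SobolevFamily d ι u) (hG : gram d ι u = 1) {ω₁ ω₂ : ι → ℝ}
    (h₁ : ∀ n, 0 ≤ ω₁ n ∧ ω₁ n ≤ 1) (h₂ : ∀ n, 0 ≤ ω₂ n ∧ ω₂ n ≤ 1) {a b : ℝ} (ha : 0 ≤ a)
    (hb : 0 ≤ b) (hab : a + b = 1) :
    a * weightedEnergy d p ω₁ u + b * weightedEnergy d p ω₂ u ≤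
      weightedEnergy d p (fun n => a * ω₁ n + b * ω₂ n) u := by
  obtain ⟨C, hC⟩ := weightedDensity_integral_bound hd hp1 hp2 ι one_pos
  have i₁ := (hC u hu hG ω₁ (fun n => (h₁ n).1) fun n => (h₁ n).2).1
  have i₂ := (hC u hu hG ω₂ (fun n => (h₂ n).1) fun n => (h₂ n).2).1
  have h0 : ∀ n, 0 ≤ a * ω₁ n + b * ω₂ n := fun n => by
    have := (h₁ n).1; have := (h₂ n).1; positivity
  have i₃ := (hC u hu hG (fun n => a * ω₁ n + b * ω₂ n) h0 fun n => by
    nlinarith [(h₁ n).2, (h₂ n).2]).1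
  have hkin : weightedKinetic d (fun n => a * ω₁ n + b * ω₂ n) u =
      a * weightedKinetic d ω₁ u + b * weightedKinetic d ω₂ u := by
    simp only [weightedKinetic, Finset.mul_sum, ← Finset.sum_add_distrib]
    exact Finset.sum_congr rfl fun n _ => by ring
  have hden : ∀ x, weightedDensity d (fun n => a * ω₁ n + b * ω₂ n) u x =
      a * weightedDensity d ω₁ u x + b * weightedDensity d ω₂ u x := by
    intro x
    simp only [weightedDensity, Finset.mul_sum, ← Finset.sum_add_distrib]
    exact Finset.sum_congr rfl fun n _ => by ring
  have hconv : ∫ x, weightedDensity d (fun n => a * ω₁ n + b * ω₂ n) u x ^ p ≤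
      a * (∫ x, weightedDensity d ω₁ u x ^ p) + b * ∫ x, weightedDensity d ω₂ u x ^ p := by
    rw [← integral_const_mul, ← integral_const_mul,
      ← integral_add (i₁.const_mul a) (i₂.const_mul b)]
    refine integral_mono i₃ ((i₁.const_mul a).add (i₂.const_mul b)) fun x => ?_
    simp only [hden]
    exact (convexOn_rpow hp1.le).2 (weightedDensity_nonneg (fun n => (h₁ n).1) u x)
      (weightedDensity_nonneg (fun n => (h₂ n).1) u x) ha hb hab
  have hp : 0 < 1 / p := by positivity
  have := mul_le_mul_of_nonneg_left hconv hp.le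
  simp only [weightedEnergy, hkin]
  linarith

theorem wt_pos {lam : ℝ} (h : 0 < lam) (n : Fin ⌈lam⌉₊) : 0 < wt ⌈lam⌉₊ lam n := by
  have := Nat.ceil_lt_add_one h.le
  unfold wt
  split_ifs <;> linarith

theorem wt_le_one {lam : ℝ} (n : Fin ⌈lam⌉₊) : wt ⌈lam⌉₊ lam n ≤ 1 := by
  have := Nat.le_ceil lam
  unfold wt
  split_ifs <;> linarith

theorem Jw_le_energyW (hd : 1 ≤ d) {p : ℝ} (hp1 : 1 < p) (hp2 : p < 1 + 2 / d) {lam : ℝ}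
    (hlam : 0 < lam) {u : Fin ⌈lam⌉₊ → Ed d → ℂ} (hu : Admissible d ⌈lam⌉₊ u) :
    Jw d p lam ≤ energyW d ⌈lam⌉₊ p lam u := by
  obtain ⟨C, hC⟩ := bddBelow_weightedEnergy (d := d) hd hp1 hp2 (wt_pos hlam) wt_le_one
  refine csInf_le ⟨C, ?_⟩ ⟨u, hu, rfl⟩
  rintro _ ⟨v, hv, rfl⟩
  exact hC v hv.sobolevFamily hv.gram_eq_one

/-- An orthonormal family whose weights are `1` on `S \ {i}`, fractional at `i` and zero off `S`
is a competitor for `Jw`. -/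
theorem Jw_le_weightedEnergy (hd : 1 ≤ d) {p : ℝ} (hp1 : 1 < p) (hp2 : p < 1 + 2 / d)
    [DecidableEq ι] {lam : ℝ} (hlam : 0 < lam) (hu : SobolevFamily d ι u) (hG : gram d ι u = 1)
    {S : Finset ι} (hS : S.card = ⌈lam⌉₊) {i : ι} (hi : i ∈ S) {ω : ι → ℝ}
    (hωi : ω i = lam - ⌈lam⌉₊ + 1) (hω1 : ∀ n ∈ S, n ≠ i → ω n = 1) (hω0 : ∀ n ∉ S, ω n = 0) :
    Jw d p lam ≤ weightedEnergy d p ω u := by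
  have hN : 0 < ⌈lam⌉₊ := Nat.ceil_pos.2 hlam
  set last : Fin ⌈lam⌉₊ := ⟨⌈lam⌉₊ - 1, by omega⟩ with hlast
  obtain ⟨e, he⟩ : ∃ e : Fin ⌈lam⌉₊ ≃ S, e last = ⟨i, hi⟩ := by
    set e₀ : Fin ⌈lam⌉₊ ≃ S := (S.equivFinOfCardEq hS).symm
    exact ⟨(Equiv.swap last (e₀.symm ⟨i, hi⟩)).trans e₀, by simp⟩
  have hinj : Function.Injective fun n => (e n : ι) :=
    Subtype.val_injective.comp e.injective
  have hwt : ∀ n, wt ⌈lam⌉₊ lam n = ω (e n) := by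
    intro n
    unfold wt
    split_ifs with h
    · have : n = last := Fin.ext h
      rw [this, he, hωi]
    · rw [hω1 _ (e n).2]
      intro h'
      have h2 : e n = e last := by rw [he]; exact Subtype.ext h'
      exact h (congrArg Fin.val (e.injective h2))
  have hsum : ∀ f : ι → ℝ, ∑ n, ω n * f n = ∑ n, wt ⌈lam⌉₊ lam n * f (e n) := by
    intro f
    simp_rw [hwt]
    rw [e.sum_comp (fun s : S => ω s * f s), Finset.sum_coe_sort S (fun s => ω s * f s)]
    refine (Finset.sum_subset (Finset.subset_univ S) fun n _ hn => ?_).symm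
    rw [hω0 n hn, zero_mul]
  have hadm : Admissible d ⌈lam⌉₊ fun n => u (e n) := by
    refine ⟨fun n => hu.contDiff _, fun n => hu.sqInt _, fun n => hu.gradSqInt _, fun j k => ?_⟩
    have := congrFun (congrFun hG (e j)) (e k)
    rw [Matrix.one_apply] at this
    simpa [gram, hinj.eq_iff] using this
  refine (Jw_le_energyW hd hp1 hp2 hlam hadm).trans_eq ?_
  simp only [energyW, weightedEnergy, kineticW, weightedKinetic, densityW, weightedDensity, hsum]

end families

/-- Occupation weights equal to `s` at `i`, to `t` at `j` and to `1` elsewhere. -/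
def pairWeight {ι : Type} [DecidableEq ι] (i j : ι) (s t : ℝ) (n : ι) : ℝ :=
  if n = i then s else if n = j then t else 1

theorem pairWeight_mem {ι : Type} [DecidableEq ι] {i j : ι} {s t : ℝ} (hs : 0 ≤ s ∧ s ≤ 1) (ht : 0 ≤ t ∧ t ≤ 1) (n : ι) :
    0 ≤ pairWeight i j s t n ∧ pairWeight i j s t n ≤ 1 := by
  unfold pairWeight
  split_ifs
  exacts [hs, ht, ⟨zero_le_one, le_rfl⟩]

section pairs

variable {d : ℕ} {ι : Type} [Fintype ι] [DecidableEq ι] {u : ι → Ed d → ℂ}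

theorem le_weightedEnergy_pairWeight (hd : 1 ≤ d) {p : ℝ} (hp1 : 1 < p) (hp2 : p < 1 + 2 / d)
    (hu : SobolevFamily d ι u) (hG : gram d ι u = 1) {i j : ι} {s₁ t₁ s₂ t₂ a b m : ℝ}
    (hs₁ : 0 ≤ s₁ ∧ s₁ ≤ 1) (ht₁ : 0 ≤ t₁ ∧ t₁ ≤ 1) (hs₂ : 0 ≤ s₂ ∧ s₂ ≤ 1)
    (ht₂ : 0 ≤ t₂ ∧ t₂ ≤ 1) (ha : 0 ≤ a) (hb : 0 ≤ b) (hab : a + b = 1)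
    (h₁ : m ≤ weightedEnergy d p (pairWeight i j s₁ t₁) u)
    (h₂ : m ≤ weightedEnergy d p (pairWeight i j s₂ t₂) u) :
    m ≤ weightedEnergy d p (pairWeight i j (a * s₁ + b * s₂) (a * t₁ + b * t₂)) u := by
  have h := weightedEnergy_concave hd hp1 hp2 hu hG (pairWeight_mem (i := i) (j := j) hs₁ ht₁)
    (pairWeight_mem (i := i) (j := j) hs₂ ht₂) ha hb hab
  have e : (fun n => a * pairWeight i j s₁ t₁ n + b * pairWeight i j s₂ t₂ n) =
      pairWeight i j (a * s₁ + b * s₂) (a * t₁ + b * t₂) := by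
    ext n
    unfold pairWeight
    split_ifs
    exacts [rfl, rfl, by linarith]
  rw [e] at h
  refine le_trans ?_ h
  calc m = a * m + b * m := by rw [← add_mul, hab, one_mul]
    _ ≤ _ := by gcongr

/-- Two fractionally occupied orbitals can be merged without raising the energy. -/
theorem Jw_le_weightedEnergy_pairWeight (hd : 1 ≤ d) {p : ℝ} (hp1 : 1 < p) (hp2 : p < 1 + 2 / d)
    (hu : SobolevFamily d ι u) (hG : gram d ι u = 1) {i j : ι} (hij : i ≠ j) {a b lam : ℝ}
    (ha : 0 < a) (ha1 : a ≤ 1) (hb : 0 < b) (hb1 : b ≤ 1)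
    (hlam : lam = Fintype.card ι - 2 + a + b) :
    Jw d p lam ≤ weightedEnergy d p (pairWeight i j a b) u := by
  have hcard : 2 ≤ Fintype.card ι := by
    rw [← Finset.card_pair hij]
    exact Finset.card_le_univ _
  have hcard' : (2 : ℝ) ≤ Fintype.card ι := by exact_mod_cast hcard
  have hlam0 : 0 < lam := by linarith
  rcases lt_or_ge 1 (a + b) with h | h
  · have hceil : ⌈lam⌉₊ = Fintype.card ι := by
      rw [Nat.ceil_eq_iff (by omega)]
      rw [Nat.cast_sub (by omega)]
      push_cast
      constructor <;> linarith
    have hS : (Finset.univ : Finset ι).card = ⌈lam⌉₊ := by rw [hceil, Finset.card_univ]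
    have hc : lam - (⌈lam⌉₊ : ℝ) + 1 = a + b - 1 := by rw [hceil]; linarith
    have h₁ : Jw d p lam ≤ weightedEnergy d p (pairWeight i j 1 (a + b - 1)) u := by
      refine Jw_le_weightedEnergy hd hp1 hp2 hlam0 hu hG hS (Finset.mem_univ j) ?_ ?_ ?_
      · simp [pairWeight, hij.symm, hc]
      · intro n _ hn
        simp [pairWeight, hn]
      · simp
    have h₂ : Jw d p lam ≤ weightedEnergy d p (pairWeight i j (a + b - 1) 1) u := by
      refine Jw_le_weightedEnergy hd hp1 hp2 hlam0 hu hG hS (Finset.mem_univ i) ?_ ?_ ?_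
      · simp [pairWeight, hc]
      · intro n _ hn
        simp [pairWeight, hn]
      · simp
    rcases eq_or_lt_of_le (show a + b ≤ 2 by linarith) with h2 | h2
    · have : b = 1 := by linarith
      have : a = 1 := by linarith
      subst_vars
      norm_num at h₁
      exact h₁
    · have h2' : 0 < 2 - a - b := by linarith
      have := le_weightedEnergy_pairWeight hd hp1 hp2 hu hG (a := (1 - b) / (2 - a - b))
        (b := (1 - a) / (2 - a - b)) ⟨zero_le_one, le_rfl⟩ ⟨by linarith, by linarith⟩
        ⟨by linarith, by linarith⟩ ⟨zero_le_one, le_rfl⟩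
        (div_nonneg (by linarith) h2'.le) (div_nonneg (by linarith) h2'.le)
        (by field_simp; ring) h₁ h₂
      convert this using 2
      congr 1
      · field_simp; ring
      · field_simp; ring
  · have hceil : ⌈lam⌉₊ = Fintype.card ι - 1 := by
      rw [Nat.ceil_eq_iff (by omega)]
      rw [Nat.cast_sub (by omega), Nat.cast_sub (by omega)]
      push_cast
      constructor <;> linarith
    have hS : ∀ k : ι, (Finset.univ.erase k).card = ⌈lam⌉₊ := fun k => by
      rw [hceil, Finset.card_erase_of_mem (Finset.mem_univ k), Finset.card_univ]
    have hc : lam - (⌈lam⌉₊ : ℝ) + 1 = a + b := by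
      rw [hceil, Nat.cast_sub (by omega)]; push_cast; linarith
    have h₁ : Jw d p lam ≤ weightedEnergy d p (pairWeight i j (a + b) 0) u := by
      refine Jw_le_weightedEnergy hd hp1 hp2 hlam0 hu hG (hS j) (i := i) (by simpa) ?_ ?_ ?_
      · simp [pairWeight, hc]
      · intro n hn hn'
        simp [pairWeight, hn', Finset.ne_of_mem_erase hn]
      · simp [pairWeight, hij.symm]
    have h₂ : Jw d p lam ≤ weightedEnergy d p (pairWeight i j 0 (a + b)) u := by
      refine Jw_le_weightedEnergy hd hp1 hp2 hlam0 hu hG (hS i) (i := j) (by simpa using hij.symm)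
        ?_ ?_ ?_
      · simp [pairWeight, hc, hij.symm]
      · intro n hn hn'
        simp [pairWeight, hn', Finset.ne_of_mem_erase hn]
      · simp [pairWeight]
    have h0 : 0 < a + b := by linarith
    have := le_weightedEnergy_pairWeight hd hp1 hp2 hu hG (a := a / (a + b))
      (b := b / (a + b)) ⟨h0.le, h⟩ ⟨le_rfl, zero_le_one⟩ ⟨le_rfl, zero_le_one⟩ ⟨h0.le, h⟩
      (by positivity) (by positivity) (by field_simp) h₁ h₂
    convert this using 2
    congr 1
    · field_simp; ring
    · field_simp; ring

end pairs

theorem Jw_le_weightedEnergy_sumElim {d : ℕ} (hd : 1 ≤ d) {p : ℝ} (hp1 : 1 < p)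
    (hp2 : p < 1 + 2 / d) {lam' lam'' : ℝ} (h' : 0 < lam') (h'' : 0 < lam'')
    {u : Fin ⌈lam'⌉₊ ⊕ Fin ⌈lam''⌉₊ → Ed d → ℂ} (hu : SobolevFamily d _ u)
    (hG : gram d _ u = 1) :
    Jw d p (lam' + lam'') ≤
      weightedEnergy d p (Sum.elim (wt ⌈lam'⌉₊ lam') (wt ⌈lam''⌉₊ lam'')) u := by
  have hN' : 0 < ⌈lam'⌉₊ := Nat.ceil_pos.2 h'
  have hN'' : 0 < ⌈lam''⌉₊ := Nat.ceil_pos.2 h''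
  set i : Fin ⌈lam'⌉₊ := ⟨⌈lam'⌉₊ - 1, by omega⟩ with hi
  set j : Fin ⌈lam''⌉₊ := ⟨⌈lam''⌉₊ - 1, by omega⟩ with hj
  have e : Sum.elim (wt ⌈lam'⌉₊ lam') (wt ⌈lam''⌉₊ lam'') =
      pairWeight (Sum.inl i) (Sum.inr j) (lam' - ⌈lam'⌉₊ + 1) (lam'' - ⌈lam''⌉₊ + 1) := by
    ext n
    rcases n with n | n <;> simp [pairWeight, wt, Fin.ext_iff, hi, hj]
  rw [e]
  have := Nat.ceil_lt_add_one h'.le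
  have := Nat.ceil_lt_add_one h''.le
  have := Nat.le_ceil lam'
  have := Nat.le_ceil lam''
  refine Jw_le_weightedEnergy_pairWeight hd hp1 hp2 hu hG (by simp) ?_ ?_ ?_ ?_ ?_
  · linarith
  · linarith
  · linarith
  · linarith
  · simp only [Fintype.card_sum, Fintype.card_fin]
    push_cast
    ring

section matrices

open scoped Matrix.Norms.L2Operator

theorem norm_matrix_entry_le_l2_opNorm {ι : Type} [Fintype ι] [DecidableEq ι] (M : Matrix ι ι ℂ)
    (i j : ι) : ‖M i j‖ ≤ ‖M‖ := by
  have h := Matrix.l2_opNorm_mulVec M (EuclideanSpace.single j (1 : ℂ))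
  have h2 := PiLp.norm_apply_le
    ((EuclideanSpace.equiv ι ℂ).symm (M.mulVec (EuclideanSpace.single j (1 : ℂ)).ofLp)) i
  simp at h h2
  exact h2.trans h

/-- A Hermitian matrix close to `1` is orthonormalized by a matrix close to `1`, namely its
inverse square root. -/
theorem eventually_exists_orthonormalizing {ι : Type} [Fintype ι] [DecidableEq ι] {ε : ℝ}
    (hε : 0 < ε) : ∀ᶠ G : Matrix ι ι ℂ in 𝓝 1, G.IsHermitian →
      ∃ B : Matrix ι ι ℂ, B * G * B.conjTranspose = 1 ∧
        ∀ i j, ‖B i j - (1 : Matrix ι ι ℂ) i j‖ ≤ ε := by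
  have hcont : ContinuousAt (fun x : ℝ => (√x)⁻¹ - 1) 1 := by
    refine ContinuousAt.sub (ContinuousAt.inv₀ (by fun_prop) (by simp)) (by fun_prop)
  have hev : ∀ᶠ x : ℝ in 𝓝 1, ‖(√x)⁻¹ - 1‖ ≤ ε ∧ 0 < x := by
    refine Eventually.and ?_ (lt_mem_nhds one_pos)
    have := hcont.norm
    refine this.eventually (ge_mem_nhds ?_)
    simpa using hε
  obtain ⟨δ, hδ, hball⟩ := Metric.eventually_nhds_iff.1 hev
  filter_upwards [Metric.ball_mem_nhds (1 : Matrix ι ι ℂ) hδ] with G hG hH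
  have hsa : IsSelfAdjoint G := hH
  rw [mem_ball_iff_norm] at hG
  have hsub : cfc (fun x : ℝ => x - 1) G = G - 1 := by
    rw [cfc_sub (fun x : ℝ => x) (fun _ => 1) G, cfc_id' ℝ G, cfc_const_one ℝ G]
  have hspec : ∀ x ∈ spectrum ℝ G, ‖(√x)⁻¹ - 1‖ ≤ ε ∧ 0 < x := by
    intro x hx
    refine hball ?_
    rw [dist_eq_norm]
    refine lt_of_le_of_lt ?_ hG
    rw [← hsub]
    exact norm_apply_le_norm_cfc (fun x : ℝ => x - 1) G hx
  have hc : ContinuousOn (fun x : ℝ => (√x)⁻¹) (spectrum ℝ G) := by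
    refine ContinuousOn.inv₀ (by fun_prop) fun x hx => ?_
    exact (Real.sqrt_pos.2 (hspec x hx).2).ne'
  refine ⟨cfc (fun x : ℝ => (√x)⁻¹) G, ?_, fun i j => ?_⟩
  · have hstar : (cfc (fun x : ℝ => (√x)⁻¹) G).conjTranspose = cfc (fun x : ℝ => (√x)⁻¹) G :=
      IsSelfAdjoint.star_eq (cfc_predicate _ G)
    rw [hstar]
    nth_rewrite 2 [← cfc_id' ℝ G]
    rw [← cfc_mul _ _ G hc, ← cfc_mul (fun x : ℝ => (√x)⁻¹ * x) _ G (hc.mul (by fun_prop)) hc, ← cfc_const_one ℝ G]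
    refine cfc_congr fun x hx => ?_
    have hx := (hspec x hx).2
    have := Real.sqrt_pos.2 hx
    have h2 := Real.mul_self_sqrt hx.le
    field_simp
    linarith
  · have : cfc (fun x : ℝ => (√x)⁻¹ - 1) G = cfc (fun x : ℝ => (√x)⁻¹) G - 1 := by
      rw [cfc_sub (fun x : ℝ => (√x)⁻¹) (fun _ => 1) G hc, cfc_const_one ℝ G]
    rw [← Matrix.sub_apply, ← this]
    exact (norm_matrix_entry_le_l2_opNorm _ i j).trans (norm_cfc_le hε.le fun x hx => (hspec x hx).1)

end matrices

theorem abs_norm_sq_sub_norm_sq_le {V : Type} [NormedAddCommGroup V] (X Y : V) :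
    |‖Y‖ ^ 2 - ‖X‖ ^ 2| ≤ ‖Y - X‖ * (2 * ‖X‖ + ‖Y - X‖) := by
  have h1 := abs_norm_sub_norm_le Y X
  have h2 : ‖Y‖ ≤ ‖X‖ + ‖Y - X‖ := by
    simpa using norm_add_le X (Y - X)
  have e : ‖Y‖ ^ 2 - ‖X‖ ^ 2 = (‖Y‖ - ‖X‖) * (‖Y‖ + ‖X‖) := by ring
  rw [e, abs_mul, abs_of_nonneg (by positivity : 0 ≤ ‖Y‖ + ‖X‖)]
  exact mul_le_mul h1 (by linarith) (by positivity) (by positivity)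

theorem exists_weighted_norm_sq_perturbation {ι : Type} [Fintype ι] [DecidableEq ι] {ω : ι → ℝ}
    (hω : ∀ n, 0 < ω n) {η : ℝ} (hη : 0 < η) :
    ∃ δ : ℝ, 0 < δ ∧ ∀ B : Matrix ι ι ℂ, (∀ i j, ‖B i j - (1 : Matrix ι ι ℂ) i j‖ ≤ δ) →
      ∀ (V : Type) [NormedAddCommGroup V] [NormedSpace ℂ V] (X : ι → V),
      |∑ n, ω n * ‖∑ m, B n m • X m‖ ^ 2 - ∑ n, ω n * ‖X n‖ ^ 2| ≤ η * ∑ n, ω n * ‖X n‖ ^ 2 := by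
  set Ω := ∑ n, ω n with hΩ
  set K := Fintype.card ι * ∑ n, (ω n)⁻¹ with hK
  have hΩ0 : 0 ≤ Ω := Finset.sum_nonneg fun n _ => (hω n).le
  have hinv : ∀ n, 0 ≤ (ω n)⁻¹ := fun n => (inv_pos.2 (hω n)).le
  have hK0 : 0 ≤ K := mul_nonneg (by positivity) (Finset.sum_nonneg fun n _ => hinv n)
  set δ := min 1 (η / (3 * Ω * K + 1)) with hδ
  have hδ0 : 0 < δ := by positivity
  have hδ1 : δ ≤ 1 := min_le_left _ _
  have hδη : 3 * δ * Ω * K ≤ η := by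
    have h : δ ≤ η / (3 * Ω * K + 1) := min_le_right _ _
    rw [le_div_iff₀ (by positivity)] at h
    nlinarith
  refine ⟨δ, hδ0, fun B hB V _ _ X => ?_⟩
  set S := ∑ n, ‖X n‖ with hS
  set E := ∑ n, ω n * ‖X n‖ ^ 2 with hE
  have hE0 : 0 ≤ E := Finset.sum_nonneg fun n _ => mul_nonneg (hω n).le (by positivity)
  have hS0 : 0 ≤ S := Finset.sum_nonneg fun n _ => norm_nonneg _
  have hXS : ∀ n, ‖X n‖ ≤ S := fun n =>
    Finset.single_le_sum (f := fun n => ‖X n‖) (fun n _ => norm_nonneg _) (Finset.mem_univ n)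
  have hSE : S ^ 2 ≤ K * E := by
    calc S ^ 2 ≤ Fintype.card ι * ∑ n, ‖X n‖ ^ 2 := sq_sum_le_card_mul_sum_sq
      _ ≤ Fintype.card ι * ∑ n, (ω n)⁻¹ * E := by
          gcongr with n
          rw [← div_eq_inv_mul, le_div_iff₀ (hω n), mul_comm]
          exact Finset.single_le_sum (f := fun n => ω n * ‖X n‖ ^ 2)
            (fun n _ => mul_nonneg (hω n).le (by positivity)) (Finset.mem_univ n)
      _ = K * E := by rw [← Finset.sum_mul, hK, mul_assoc]
  have hdiff : ∀ n, ‖∑ m, B n m • X m - X n‖ ≤ δ * S := by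
    intro n
    have e : ∑ m, B n m • X m - X n = ∑ m, (B n m - (1 : Matrix ι ι ℂ) n m) • X m := by
      simp [sub_smul, Finset.sum_sub_distrib, Matrix.one_apply]
    rw [e, hS, Finset.mul_sum]
    refine norm_sum_le_of_le _ fun m _ => ?_
    rw [norm_smul]
    gcongr
    exact hB n m
  have hn : ∀ n, |‖∑ m, B n m • X m‖ ^ 2 - ‖X n‖ ^ 2| ≤ 3 * δ * S ^ 2 := by
    intro n
    refine (abs_norm_sq_sub_norm_sq_le _ _).trans ?_
    calc _ ≤ (δ * S) * (2 * S + 1 * S) := by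
          gcongr
          · exact hdiff n
          · exact hXS n
          · exact (hdiff n).trans (by gcongr)
      _ = _ := by ring
  rw [← Finset.sum_sub_distrib]
  calc |∑ n, (ω n * ‖∑ m, B n m • X m‖ ^ 2 - ω n * ‖X n‖ ^ 2)|
      ≤ ∑ n, |ω n * ‖∑ m, B n m • X m‖ ^ 2 - ω n * ‖X n‖ ^ 2| := Finset.abs_sum_le_sum_abs _ _
    _ ≤ ∑ n, ω n * (3 * δ * S ^ 2) := by
        refine Finset.sum_le_sum fun n _ => ?_
        rw [← mul_sub, abs_mul, abs_of_pos (hω n)]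
        exact mul_le_mul_of_nonneg_left (hn n) (hω n).le
    _ = 3 * δ * Ω * S ^ 2 := by rw [← Finset.sum_mul]; ring
    _ ≤ 3 * δ * Ω * (K * E) := by gcongr
    _ = 3 * δ * Ω * K * E := by ring
    _ ≤ η * E := by gcongr

section translations

variable {d : ℕ}

theorem tendsto_setIntegral_norm_ge {h : Ed d → ℝ} (hh : Integrable h) :
    Tendsto (fun R : ℝ => ∫ x, {x | R ≤ ‖x‖}.indicator h x) atTop (𝓝 0) := by
  rw [← integral_zero (Ed d) ℝ (μ := volume)]
  refine tendsto_integral_filter_of_dominated_convergence (fun x => ‖h x‖) ?_ ?_ hh.norm ?_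
  · refine Eventually.of_forall fun R => hh.aestronglyMeasurable.indicator ?_
    exact (isClosed_le continuous_const continuous_norm).measurableSet
  · exact Eventually.of_forall fun R => Eventually.of_forall fun x =>
      norm_indicator_le_norm_self h x
  · refine Eventually.of_forall fun x => tendsto_const_nhds.congr' ?_
    filter_upwards [eventually_gt_atTop ‖x‖] with R hR
    rw [Set.indicator_of_notMem]
    simpa using hR

theorem mul_le_add_of_norm_sum_ge {η R a b s t : ℝ} (hη : 0 < η) (h : R ≤ s + t) :
    a * b ≤ η * (a ^ 2 + b ^ 2) +
      η⁻¹ * ((if R / 2 ≤ s then a ^ 2 else 0) + (if R / 2 ≤ t then b ^ 2 else 0)) := by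
  have key : ∀ a b : ℝ, a * b ≤ η * a ^ 2 + η⁻¹ * b ^ 2 := fun a b => by
    have h1 : 0 ≤ η⁻¹ * (η * a - b) ^ 2 := by positivity
    have h2 : η⁻¹ * (η * a - b) ^ 2 = η * a ^ 2 - 2 * (a * b) + η⁻¹ * b ^ 2 := by
      field_simp
      ring
    have h3 : 0 ≤ η * a ^ 2 + η⁻¹ * b ^ 2 := by positivity
    linarith
  have h1 := key a b
  have h2 := key b a
  have : 0 ≤ η * a ^ 2 := by positivity
  have : 0 ≤ η * b ^ 2 := by positivity
  have : 0 ≤ η⁻¹ * a ^ 2 := by positivity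
  have : 0 ≤ η⁻¹ * b ^ 2 := by positivity
  split_ifs <;> linarith

/-- The `L²` overlap of a function with a far translate of another tends to zero. -/
theorem tendsto_integral_mul_conj_translate {f g : Ed d → ℂ} (hf : Integrable fun x => ‖f x‖ ^ 2)
    (hg : Integrable fun x => ‖g x‖ ^ 2) {e : Ed d} (he : ‖e‖ = 1) :
    Tendsto (fun R : ℝ => ∫ x, f x * (starRingEnd ℂ) (g (x - R • e))) atTop (𝓝 0) := by
  set F := ∫ x, ‖f x‖ ^ 2 with hF
  set H := ∫ x, ‖g x‖ ^ 2 with hH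
  have hF0 : 0 ≤ F := integral_nonneg fun x => by positivity
  have hH0 : 0 ≤ H := integral_nonneg fun x => by positivity
  set tf := fun R : ℝ => ∫ x, {x : Ed d | R / 2 ≤ ‖x‖}.indicator (fun x => ‖f x‖ ^ 2) x with htf
  set tg := fun R : ℝ => ∫ x, {x : Ed d | R / 2 ≤ ‖x‖}.indicator (fun x => ‖g x‖ ^ 2) x with htg
  have hbound : ∀ η : ℝ, 0 < η → ∀ R : ℝ, 0 ≤ R →
      ‖∫ x, f x * (starRingEnd ℂ) (g (x - R • e))‖ ≤
        η * (F + H) + η⁻¹ * (tf R + tg R) := by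
    intro η hη R hR
    have hms : MeasurableSet {x : Ed d | R / 2 ≤ ‖x‖} :=
      (isClosed_le continuous_const continuous_norm).measurableSet
    have i2 : Integrable fun x => ‖g (x - R • e)‖ ^ 2 := hg.comp_sub_right (R • e)
    have i3 := hf.indicator hms
    have i4 := (hg.indicator hms).comp_sub_right (R • e)
    have e2 : ∫ x, ‖g (x - R • e)‖ ^ 2 = H :=
      integral_sub_right_eq_self (fun x => ‖g x‖ ^ 2) (R • e)
    have e4 : ∫ x, {x : Ed d | R / 2 ≤ ‖x‖}.indicator (fun x => ‖g x‖ ^ 2) (x - R • e) = tg R :=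
      integral_sub_right_eq_self
        ({x : Ed d | R / 2 ≤ ‖x‖}.indicator (fun x => ‖g x‖ ^ 2)) (R • e)
    have j1 : Integrable fun x => η * (‖f x‖ ^ 2 + ‖g (x - R • e)‖ ^ 2) :=
      (hf.add i2).const_mul η
    have j2 : Integrable fun x => η⁻¹ *
        ({x : Ed d | R / 2 ≤ ‖x‖}.indicator (fun x => ‖f x‖ ^ 2) x +
          {x : Ed d | R / 2 ≤ ‖x‖}.indicator (fun x => ‖g x‖ ^ 2) (x - R • e)) :=
      (i3.add i4).const_mul η⁻¹
    rw [hF, ← e2, htf, ← e4, ← integral_add hf i2, ← integral_add i3 i4, ← integral_const_mul,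
      ← integral_const_mul, ← integral_add j1 j2]
    refine norm_integral_le_of_norm_le (j1.add j2) (Eventually.of_forall fun x => ?_)
    have hn : ‖R • e‖ = R := by rw [norm_smul, he, mul_one, Real.norm_of_nonneg hR]
    have htri : R ≤ ‖x‖ + ‖x - R • e‖ := by
      have := norm_sub_le x (x - R • e)
      rwa [sub_sub_cancel, hn] at this
    simpa [Set.indicator_apply] using
      mul_le_add_of_norm_sum_ge (a := ‖f x‖) (b := ‖g (x - R • e)‖) hη htri
  have htail : Tendsto (fun R => tf R + tg R) atTop (𝓝 0) := by
    have hhalf : Tendsto (fun R : ℝ => R / 2) atTop atTop := tendsto_id.atTop_div_const two_pos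
    simpa using ((tendsto_setIntegral_norm_ge hf).comp hhalf).add
      ((tendsto_setIntegral_norm_ge hg).comp hhalf)
  rw [tendsto_zero_iff_norm_tendsto_zero, Metric.tendsto_nhds]
  intro ε hε
  set η := ε / (2 * (F + H + 1)) with hη
  have hη0 : 0 < η := by positivity
  have h1 : η * (F + H) < ε / 2 := by
    rw [hη, div_mul_eq_mul_div, div_lt_iff₀ (by positivity)]
    nlinarith
  have htail' : Tendsto (fun R => η⁻¹ * (tf R + tg R)) atTop (𝓝 0) := by
    simpa using htail.const_mul η⁻¹
  filter_upwards [htail'.eventually (gt_mem_nhds (half_pos hε)), eventually_ge_atTop 0] with R h2 h3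
  simp only [dist_zero_right, norm_norm]
  linarith [hbound η hη0 R h3]

end translations

section orthonormalization

variable {d : ℕ} {ι : Type} {u : ι → Ed d → ℂ}

theorem SobolevFamily.memLp (h : SobolevFamily d ι u) (n : ι) : MemLp (u n) 2 :=
  (memLp_two_iff_integrable_sq_norm (h.contDiff n).continuous.aestronglyMeasurable).2 (h.sqInt n)

theorem SobolevFamily.memLp_fderiv (h : SobolevFamily d ι u) (n : ι) :
    MemLp (fderiv ℝ (u n)) 2 :=
  (memLp_two_iff_integrable_sq_norm
    ((h.contDiff n).continuous_fderiv one_ne_zero).aestronglyMeasurable).2 (h.gradSqInt n)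

theorem SobolevFamily.integrable_mul_conj (h : SobolevFamily d ι u) (j k : ι) :
    Integrable fun x => u j x * (starRingEnd ℂ) (u k x) :=
  (h.memLp j).integrable_mul (h.memLp k).star

theorem SobolevFamily.translate (h : SobolevFamily d ι u) (a : Ed d) :
    SobolevFamily d ι fun n x => u n (x - a) where
  contDiff n := (h.contDiff n).comp (contDiff_id.sub contDiff_const)
  sqInt n := (h.sqInt n).comp_sub_right a
  gradSqInt n := by
    simp_rw [fderiv_comp_sub]
    exact (h.gradSqInt n).comp_sub_right a

theorem SobolevFamily.sumElim {κ : Type} {v : κ → Ed d → ℂ} (hu : SobolevFamily d ι u)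
    (hv : SobolevFamily d κ v) : SobolevFamily d (ι ⊕ κ) (Sum.elim u v) where
  contDiff n := by rcases n with n | n; exacts [hu.contDiff n, hv.contDiff n]
  sqInt n := by rcases n with n | n; exacts [hu.sqInt n, hv.sqInt n]
  gradSqInt n := by rcases n with n | n; exacts [hu.gradSqInt n, hv.gradSqInt n]

theorem gram_isHermitian (u : ι → Ed d → ℂ) : (gram d ι u).IsHermitian := by
  ext j k
  simp only [Matrix.conjTranspose_apply, gram, RCLike.star_def, ← integral_conj]
  simp [mul_comm]

theorem integrable_norm_sq_of_hasCompactSupport {V : Type} [NormedAddCommGroup V]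
    {F : Ed d → V} (hF : Continuous F) (hFc : HasCompactSupport F) :
    Integrable fun x => ‖F x‖ ^ 2 := by
  have hc : HasCompactSupport fun x => ‖F x‖ ^ 2 :=
    hFc.norm.comp_left (g := fun y : ℝ => y ^ 2) (by simp)
  exact (hF.norm.pow 2).integrable_of_hasCompactSupport hc

theorem sobolevFamily_of_hasCompactSupport {g : Ed d → ℂ} (hg : ContDiff ℝ 1 g)
    (hgc : HasCompactSupport g) : SobolevFamily d Unit fun _ => g where
  contDiff _ := hg
  sqInt _ := integrable_norm_sq_of_hasCompactSupport hg.continuous hgc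
  gradSqInt _ := integrable_norm_sq_of_hasCompactSupport (hg.continuous_fderiv one_ne_zero)
    (hgc.fderiv ℝ)

variable [Fintype ι]

theorem integrable_norm_sq_sum_smul {V : Type} [NormedAddCommGroup V] [NormedSpace ℂ V]
    {F : ι → Ed d → V} (hF : ∀ m, MemLp (F m) 2) (c : ι → ℂ) :
    Integrable fun x => ‖∑ m, c m • F m x‖ ^ 2 := by
  have : MemLp (fun x => ∑ m, c m • F m x) 2 :=
    memLp_finsetSum _ fun m _ => (hF m).const_smul (c m)
  exact (memLp_two_iff_integrable_sq_norm this.aestronglyMeasurable).1 this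

/-- The family obtained by applying a matrix to a family. -/
def mixFamily (B : Matrix ι ι ℂ) (u : ι → Ed d → ℂ) (n : ι) (x : Ed d) : ℂ :=
  ∑ m, B n m • u m x

theorem SobolevFamily.fderiv_mixFamily (h : SobolevFamily d ι u) (B : Matrix ι ι ℂ) (n : ι)
    (x : Ed d) : fderiv ℝ (mixFamily B u n) x = ∑ m, B n m • fderiv ℝ (u m) x := by
  refine HasFDerivAt.fderiv (HasFDerivAt.fun_sum fun m _ => ?_)
  exact (((h.contDiff m).differentiable one_ne_zero) x).hasFDerivAt.const_smul (B n m)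

theorem SobolevFamily.mixFamily (h : SobolevFamily d ι u) (B : Matrix ι ι ℂ) :
    SobolevFamily d ι (mixFamily B u) where
  contDiff n := ContDiff.sum fun m _ => (h.contDiff m).const_smul (B n m)
  sqInt n := integrable_norm_sq_sum_smul h.memLp (B n)
  gradSqInt n := by
    simp_rw [h.fderiv_mixFamily B n]
    exact integrable_norm_sq_sum_smul h.memLp_fderiv (B n)

theorem SobolevFamily.gram_mixFamily (h : SobolevFamily d ι u) (B : Matrix ι ι ℂ) :
    gram d ι (_root_.mixFamily B u) = B * gram d ι u * B.conjTranspose := by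
  ext j k
  have e : ∀ x, _root_.mixFamily B u j x * (starRingEnd ℂ) (_root_.mixFamily B u k x) =
      ∑ l, ∑ m, (B j m * (starRingEnd ℂ) (B k l)) * (u m x * (starRingEnd ℂ) (u l x)) := by
    intro x
    simp only [_root_.mixFamily, smul_eq_mul, map_sum, map_mul, Finset.mul_sum, Finset.sum_mul]
    exact Finset.sum_congr rfl fun l _ => Finset.sum_congr rfl fun m _ => by ring
  have hi := fun l m => (h.integrable_mul_conj m l).const_mul (B j m * (starRingEnd ℂ) (B k l))
  simp only [gram, e, Matrix.mul_apply, Matrix.conjTranspose_apply, RCLike.star_def,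
    Finset.sum_mul]
  rw [integral_finsetSum _ fun l _ => integrable_finsetSum _ fun m _ => hi l m]
  refine Finset.sum_congr rfl fun l _ => ?_
  rw [integral_finsetSum _ fun m _ => hi l m]
  refine Finset.sum_congr rfl fun m _ => ?_
  rw [integral_const_mul]
  ring

/-- A family whose Gram matrix is close to `1` can be orthonormalized with little change in
density and kinetic energy. -/
theorem eventually_exists_orthonormal [DecidableEq ι] {ω : ι → ℝ} (hω : ∀ n, 0 < ω n) {η : ℝ}
    (hη : 0 < η) : ∀ᶠ G : Matrix ι ι ℂ in 𝓝 1, ∀ w : ι → Ed d → ℂ, SobolevFamily d ι w →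
      gram d ι w = G → ∃ v : ι → Ed d → ℂ, SobolevFamily d ι v ∧ gram d ι v = 1 ∧
        weightedKinetic d ω v ≤ (1 + η) * weightedKinetic d ω w ∧
        ∀ x, (1 - η) * weightedDensity d ω w x ≤ weightedDensity d ω v x := by
  obtain ⟨δ, hδ, hB⟩ := exists_weighted_norm_sq_perturbation hω hη
  filter_upwards [eventually_exists_orthonormalizing (ι := ι) hδ] with G hG w hw hwG
  obtain ⟨B, hB1, hBδ⟩ := hG (hwG ▸ gram_isHermitian w)
  have hv := hw.mixFamily B
  refine ⟨mixFamily B w, hv, by rw [hw.gram_mixFamily, hwG, hB1], ?_, fun x => ?_⟩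
  · have hsum : ∀ {v : ι → Ed d → ℂ}, SobolevFamily d ι v →
        weightedKinetic d ω v = ∫ x, ∑ n, ω n * ‖fderiv ℝ (v n) x‖ ^ 2 := fun hv => by
      rw [integral_finsetSum _ fun n _ => (hv.gradSqInt n).const_mul _]
      simp_rw [integral_const_mul]
      rfl
    rw [hsum hv, hsum hw, ← integral_const_mul]
    refine integral_mono (integrable_finsetSum _ fun n _ => (hv.gradSqInt n).const_mul _)
      ((integrable_finsetSum _ fun n _ => (hw.gradSqInt n).const_mul _).const_mul _) fun x => ?_
    have := (abs_le.1 (hB B hBδ _ fun n => fderiv ℝ (w n) x)).2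
    simp only [hw.fderiv_mixFamily]
    linarith
  · have := (abs_le.1 (hB B hBδ _ fun n => w n x)).1
    simp only [weightedDensity, mixFamily]
    linarith

end orthonormalization

theorem tendsto_gram_sumElim_translate {d : ℕ} {ι κ : Type} [DecidableEq ι] [DecidableEq κ]
    {u : ι → Ed d → ℂ} {v : κ → Ed d → ℂ} (hu : SobolevFamily d ι u) (hv : SobolevFamily d κ v)
    (hGu : gram d ι u = 1) (hGv : gram d κ v = 1) {e : Ed d} (he : ‖e‖ = 1) :
    Tendsto (fun R : ℝ => gram d (ι ⊕ κ) (Sum.elim u fun n x => v n (x - R • e)))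
      atTop (𝓝 1) := by
  refine tendsto_pi_nhds.2 fun j => tendsto_pi_nhds.2 fun k => ?_
  rcases j with j | j <;> rcases k with k | k
  · have : ∀ R : ℝ, gram d (ι ⊕ κ) (Sum.elim u fun n x => v n (x - R • e)) (Sum.inl j) (Sum.inl k)
        = (1 : Matrix (ι ⊕ κ) (ι ⊕ κ) ℂ) (Sum.inl j) (Sum.inl k) := by
      intro R
      have h := congrFun (congrFun hGu j) k
      simpa [gram, Matrix.one_apply] using h
    simp_rw [this]
    exact tendsto_const_nhds
  · simpa [gram, Matrix.one_apply] using
      tendsto_integral_mul_conj_translate (hu.sqInt j) (hv.sqInt k) he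
  · have h := (Complex.continuous_conj.tendsto _).comp
      (tendsto_integral_mul_conj_translate (hu.sqInt k) (hv.sqInt j) he)
    simp only [Function.comp_def, ← integral_conj] at h
    simpa [gram, Matrix.one_apply, mul_comm] using h
  · have : ∀ R : ℝ, gram d (ι ⊕ κ) (Sum.elim u fun n x => v n (x - R • e)) (Sum.inr j) (Sum.inr k)
        = (1 : Matrix (ι ⊕ κ) (ι ⊕ κ) ℂ) (Sum.inr j) (Sum.inr k) := by
      intro R
      have h := congrFun (congrFun hGv j) k
      rw [Matrix.one_apply] at h ⊢
      simp only [Sum.inr.injEq]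
      rw [← h]
      exact integral_sub_right_eq_self (fun x => v j x * (starRingEnd ℂ) (v k x)) (R • e)
    simp_rw [this]
    exact tendsto_const_nhds

theorem weightedKinetic_sumElim_translate {d : ℕ} {ι κ : Type} [Fintype ι] [Fintype κ]
    (ω : ι → ℝ) (ω' : κ → ℝ) (u : ι → Ed d → ℂ) (v : κ → Ed d → ℂ) (a : Ed d) :
    weightedKinetic d (Sum.elim ω ω') (Sum.elim u fun n x => v n (x - a)) =
      weightedKinetic d ω u + weightedKinetic d ω' v := by
  simp only [weightedKinetic, Fintype.sum_sum_type, Sum.elim_inl, Sum.elim_inr, fderiv_comp_sub]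
  congr 1
  refine Finset.sum_congr rfl fun n _ => ?_
  rw [integral_sub_right_eq_self (fun x => ‖fderiv ℝ (v n) x‖ ^ 2) a]

theorem weightedDensity_sumElim_translate {d : ℕ} {ι κ : Type} [Fintype ι] [Fintype κ]
    (ω : ι → ℝ) (ω' : κ → ℝ) (u : ι → Ed d → ℂ) (v : κ → Ed d → ℂ) (a x : Ed d) :
    weightedDensity d (Sum.elim ω ω') (Sum.elim u fun n x => v n (x - a)) x =
      weightedDensity d ω u x + weightedDensity d ω' v (x - a) := by
  simp [weightedDensity, Fintype.sum_sum_type]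

theorem exists_norm_eq_one {d : ℕ} (hd : 1 ≤ d) : ∃ e : Ed d, ‖e‖ = 1 :=
  ⟨EuclideanSpace.single ⟨0, hd⟩ 1, by simp⟩

theorem Jw_add_le_perturbed {d : ℕ} (hd : 1 ≤ d) {p : ℝ} (hp1 : 1 < p) (hp2 : p < 1 + 2 / d)
    {lam' lam'' : ℝ} (h' : 0 < lam') (h'' : 0 < lam'') {u : Fin ⌈lam'⌉₊ → Ed d → ℂ}
    {v : Fin ⌈lam''⌉₊ → Ed d → ℂ} (hu : Admissible d _ u) (hv : Admissible d _ v) {η : ℝ}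
    (hη : 0 < η) (hη1 : η < 1) :
    Jw d p (lam' + lam'') ≤
      (1 + η) * (kineticW d _ lam' u + kineticW d _ lam'' v) - (1 / p) * ((1 - η) ^ p *
        ((∫ x, densityW d _ lam' u x ^ p) + ∫ x, densityW d _ lam'' v x ^ p)) := by
  obtain ⟨e, he⟩ := exists_norm_eq_one hd
  set ω := Sum.elim (wt ⌈lam'⌉₊ lam') (wt ⌈lam''⌉₊ lam'') with hω
  have hω0 : ∀ n, 0 < ω n := by
    rintro (n | n)
    exacts [wt_pos h' n, wt_pos h'' n]
  have hω1 : ∀ n, ω n ≤ 1 := by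
    rintro (n | n)
    exacts [wt_le_one n, wt_le_one n]
  have hev := (tendsto_gram_sumElim_translate hu.sobolevFamily hv.sobolevFamily hu.gram_eq_one
    hv.gram_eq_one he).eventually (eventually_exists_orthonormal (d := d) hω0 hη)
  obtain ⟨R, hR⟩ := hev.exists
  obtain ⟨z, hz, hzG, hzT, hzρ⟩ :=
    hR _ (hu.sobolevFamily.sumElim (hv.sobolevFamily.translate (R • e))) rfl
  refine (Jw_le_weightedEnergy_sumElim hd hp1 hp2 h' h'' hz hzG).trans ?_
  rw [weightedKinetic_sumElim_translate] at hzT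
  have hP : (1 - η) ^ p * ((∫ x, densityW d _ lam' u x ^ p) + ∫ x, densityW d _ lam'' v x ^ p) ≤
      ∫ x, weightedDensity d ω z x ^ p := by
    obtain ⟨C, hC⟩ := weightedDensity_integral_bound hd hp1 hp2 (Fin ⌈lam'⌉₊ ⊕ Fin ⌈lam''⌉₊) one_pos
    obtain ⟨C', hC'⟩ := weightedDensity_integral_bound hd hp1 hp2 (Fin ⌈lam'⌉₊) one_pos
    obtain ⟨C'', hC''⟩ := weightedDensity_integral_bound hd hp1 hp2 (Fin ⌈lam''⌉₊) one_pos
    have iz := (hC z hz hzG ω (fun n => (hω0 n).le) hω1).1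
    have iu : Integrable fun x => densityW d _ lam' u x ^ p :=
      (hC' u hu.sobolevFamily hu.gram_eq_one _ (fun n => (wt_pos h' n).le) wt_le_one).1
    have iv : Integrable fun x => densityW d _ lam'' v (x - R • e) ^ p :=
      (hC'' v hv.sobolevFamily hv.gram_eq_one _ (fun n => (wt_pos h'' n).le)
        wt_le_one).1.comp_sub_right (R • e)
    rw [← integral_sub_right_eq_self (fun x => densityW d _ lam'' v x ^ p) (R • e),
      ← integral_add iu iv, ← integral_const_mul]
    refine integral_mono ((iu.add iv).const_mul _) iz fun x => ?_
    have hρ := hzρ x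
    rw [weightedDensity_sumElim_translate] at hρ
    have hu0 : 0 ≤ densityW d _ lam' u x := weightedDensity_nonneg (fun n => (wt_pos h' n).le) u x
    have hv0 : 0 ≤ densityW d _ lam'' v (x - R • e) :=
      weightedDensity_nonneg (fun n => (wt_pos h'' n).le) v (x - R • e)
    have hη' : 0 ≤ 1 - η := by linarith
    calc (1 - η) ^ p * (densityW d _ lam' u x ^ p + densityW d _ lam'' v (x - R • e) ^ p)
        ≤ (1 - η) ^ p * (densityW d _ lam' u x + densityW d _ lam'' v (x - R • e)) ^ p := by
          gcongr
          exact Real.add_rpow_le_rpow_add hu0 hv0 hp1.le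
      _ = ((1 - η) * (densityW d _ lam' u x + densityW d _ lam'' v (x - R • e))) ^ p :=
          (Real.mul_rpow hη' (by positivity)).symm
      _ ≤ weightedDensity d ω z x ^ p := Real.rpow_le_rpow (by positivity) hρ (by linarith)
  exact sub_le_sub hzT (mul_le_mul_of_nonneg_left hP (by positivity))

theorem Jw_add_le_energyW_add {d : ℕ} (hd : 1 ≤ d) {p : ℝ} (hp1 : 1 < p) (hp2 : p < 1 + 2 / d)
    {lam' lam'' : ℝ} (h' : 0 < lam') (h'' : 0 < lam'') {u : Fin ⌈lam'⌉₊ → Ed d → ℂ}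
    {v : Fin ⌈lam''⌉₊ → Ed d → ℂ} (hu : Admissible d _ u) (hv : Admissible d _ v) :
    Jw d p (lam' + lam'') ≤ energyW d _ p lam' u + energyW d _ p lam'' v := by
  set T := kineticW d _ lam' u + kineticW d _ lam'' v with hT
  set P := (∫ x, densityW d _ lam' u x ^ p) + ∫ x, densityW d _ lam'' v x ^ p with hP
  have hlim : Tendsto (fun η : ℝ => (1 + η) * T - (1 / p) * ((1 - η) ^ p * P)) (𝓝[>] 0)
      (𝓝 ((1 + 0) * T - (1 / p) * ((1 - 0) ^ p * P))) := by
    refine tendsto_nhdsWithin_of_tendsto_nhds (ContinuousAt.tendsto (f := fun η : ℝ =>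
      (1 + η) * T - (1 / p) * ((1 - η) ^ p * P)) ?_)
    have : Continuous fun η : ℝ => (1 - η) ^ p :=
      Continuous.rpow_const (by fun_prop) fun _ => Or.inr (by linarith)
    fun_prop
  have hle := ge_of_tendsto hlim (b := Jw d p (lam' + lam'')) (by
    filter_upwards [Ioo_mem_nhdsGT (zero_lt_one' ℝ)] with η hη
    exact Jw_add_le_perturbed hd hp1 hp2 h' h'' hu hv hη.1 hη.2)
  refine hle.trans_eq ?_
  rw [sub_zero, Real.one_rpow, energyW, energyW, hT, hP]
  ring

/-- Normalized translates of a bump function with disjoint supports form an admissible tuple. -/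
theorem exists_admissible {d : ℕ} (hd : 1 ≤ d) (N : ℕ) : ∃ u, Admissible d N u := by
  obtain ⟨e, he⟩ := exists_norm_eq_one hd
  let f : ContDiffBump (0 : Ed d) := ⟨1, 2, one_pos, one_lt_two⟩
  have hfc : Continuous f := f.continuous
  have hsq : HasCompactSupport fun x => f x ^ 2 :=
    f.hasCompactSupport.comp_left (g := fun y : ℝ => y ^ 2) (by simp)
  have hI : 0 < ∫ x, f x ^ 2 := by
    refine (hfc.pow 2).integral_pos_of_hasCompactSupport_nonneg_nonzero hsq
      (fun x => by positivity) (x := 0) ?_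
    rw [f.one_of_mem_closedBall (by simp [f.rIn_pos.le])]
    simp
  set c : ℝ := (√(∫ x, f x ^ 2))⁻¹ with hc
  let g : Ed d → ℂ := fun x => ((c * f x : ℝ) : ℂ)
  have hg : ContDiff ℝ 1 g := Complex.ofRealCLM.contDiff.comp (contDiff_const.mul f.contDiff)
  have hgc : HasCompactSupport g :=
    f.hasCompactSupport.comp_left (g := fun y : ℝ => ((c * y : ℝ) : ℂ)) (by simp)
  have hgs := sobolevFamily_of_hasCompactSupport hg hgc
  have hgg : ∫ x, g x * (starRingEnd ℂ) (g x) = 1 := by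
    have : ∀ x, g x * (starRingEnd ℂ) (g x) = ((c ^ 2 * f x ^ 2 : ℝ) : ℂ) := fun x => by
      simp only [g, Complex.conj_ofReal]
      push_cast
      ring
    simp_rw [this]
    rw [integral_complex_ofReal, integral_const_mul, hc, inv_pow, Real.sq_sqrt hI.le,
      inv_mul_cancel₀ hI.ne', Complex.ofReal_one]
  have hg0 : ∀ x, 2 ≤ ‖x‖ → g x = 0 := fun x hx => by
    simp only [g]
    rw [f.zero_of_le_dist (by simpa [dist_eq_norm] using hx)]
    simp
  refine ⟨fun n x => g (x - (4 * (n : ℕ) : ℝ) • e), fun n => (hgs.translate _).contDiff (),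
    fun n => (hgs.translate _).sqInt (), fun n => (hgs.translate _).gradSqInt (), fun j k => ?_⟩
  split_ifs with hjk
  · subst hjk
    rw [← hgg]
    exact integral_sub_right_eq_self (fun x => g x * (starRingEnd ℂ) (g x)) _
  · rw [← integral_zero (Ed d) ℂ]
    congr 1
    ext x
    by_contra hne
    obtain ⟨h1, h2⟩ := mul_ne_zero_iff.1 hne
    have h1 : ‖x - (4 * (j : ℕ) : ℝ) • e‖ < 2 := not_le.1 fun h => h1 (hg0 _ h)
    have h2 : ‖x - (4 * (k : ℕ) : ℝ) • e‖ < 2 := not_le.1 fun h => h2 (by rw [hg0 _ h, map_zero])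
    have h3 := norm_sub_le (x - (4 * (j : ℕ) : ℝ) • e) (x - (4 * (k : ℕ) : ℝ) • e)
    rw [sub_sub_sub_cancel_left, ← sub_smul, norm_smul, he, mul_one, ← mul_sub, norm_mul,
      Real.norm_of_nonneg zero_le_four] at h3
    have h4 : (1 : ℝ) ≤ ‖((k : ℕ) : ℝ) - ((j : ℕ) : ℝ)‖ := by
      have : (1 : ℤ) ≤ |((k : ℕ) : ℤ) - ((j : ℕ) : ℤ)| := by
        refine Int.one_le_abs (sub_ne_zero.2 fun h => hjk (Fin.ext ?_))
        exact_mod_cast h.symm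
      rw [Real.norm_eq_abs]
      exact_mod_cast this
    linarith

theorem Jw_zero {d : ℕ} {p : ℝ} (hp : 0 < p) : Jw d p 0 = 0 := by
  have hN : ⌈(0 : ℝ)⌉₊ = 0 := Nat.ceil_zero
  have he : IsEmpty (Fin ⌈(0 : ℝ)⌉₊) := by rw [hN]; infer_instance
  have henergy : ∀ u, energyW d ⌈(0 : ℝ)⌉₊ p 0 u = 0 := fun u => by
    simp [energyW, kineticW, densityW, Real.zero_rpow hp.ne']
  have hset : { e : ℝ | ∃ u : Fin ⌈(0 : ℝ)⌉₊ → Ed d → ℂ,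
      Admissible d ⌈(0 : ℝ)⌉₊ u ∧ e = energyW d ⌈(0 : ℝ)⌉₊ p 0 u } = {0} := by
    ext e
    simp only [Set.mem_ofPred_eq, henergy, Set.mem_singleton_iff, exists_and_right,
      and_iff_right_iff_imp]
    exact fun _ => ⟨fun _ _ => 0, ⟨fun n => he.elim n, fun n => he.elim n, fun n => he.elim n,
      fun n => he.elim n⟩⟩
  rw [Jw, hset, csInf_singleton]

/-- subadditivity `J(λ) ≤ J(λ') + J(λ−λ')` for `0 ≤ λ' ≤ λ`. -/
theorem statement8 (d : ℕ) (hd : 1 ≤ d) (p : ℝ) (hp1 : 1 < p)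
    (hp2 : p < 1 + 2 / d) :
    ∀ lam lam' : ℝ, 0 ≤ lam' → lam' ≤ lam →
      Jw d p lam ≤ Jw d p lam' + Jw d p (lam - lam') := by
  intro lam lam' h0 hle
  have hp : 0 < p := by linarith
  rcases h0.eq_or_lt with rfl | h'
  · rw [Jw_zero hp, sub_zero, zero_add]
  rcases hle.eq_or_lt with rfl | hlt
  · rw [sub_self, Jw_zero hp, add_zero]
  have h'' : 0 < lam - lam' := sub_pos.2 hlt
  obtain ⟨u₀, hu₀⟩ := exists_admissible hd ⌈lam'⌉₊
  obtain ⟨v₀, hv₀⟩ := exists_admissible hd ⌈lam - lam'⌉₊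
  rw [← sub_le_iff_le_add]
  refine le_csInf ⟨_, u₀, hu₀, rfl⟩ ?_
  rintro _ ⟨u, hu, rfl⟩
  rw [sub_le_comm]
  refine le_csInf ⟨_, v₀, hv₀, rfl⟩ ?_
  rintro _ ⟨v, hv, rfl⟩
  rw [sub_le_iff_le_add, add_comm]
  have h := Jw_add_le_energyW_add hd hp1 hp2 h' h'' hu hv
  rwa [add_sub_cancel] at h
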